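/- Assume (H1)-(H2) and n ≥ 2. Let μ be a Borel probability measure on ℝⁿ that is Φ-invariant, i.e. μ(Φ_t⁻¹(A)) = μ(A) for every Borel set A and all t ∈ ℝ. Then every connected component B of the support of μ either consists of equilibria with any two distinct points of B related by ≪, or B is contained in an invariant, unordered subset of ℝⁿ homeomorphic to ℝ^{n−1}. -/

import Mathlib

open Set Metric Filter Topology Pointwise

noncomputable section

abbrev Euc (n : ℕ) := EuclideanSpace ℝ (Fin n)

/-- `Φ` is a continuous flow on `ℝⁿ`. -/
def IsFlow {n : ℕ} (Φ : ℝ → Euc n → Euc n) : Prop :=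
  Continuous (fun p : ℝ × Euc n => Φ p.1 p.2) ∧
  (∀ x, Φ 0 x = x) ∧
  (∀ t s x, Φ t (Φ s x) = Φ (t + s) x)

/-- `Cp` is a closed, solid, salient convex cone. -/
def IsConeOrder {n : ℕ} (Cp : Set (Euc n)) : Prop :=
  IsClosed Cp ∧ (∀ x ∈ Cp, ∀ y ∈ Cp, x + y ∈ Cp) ∧
  (∀ α : ℝ, 0 < α → ∀ x ∈ Cp, α • x ∈ Cp) ∧
  (interior Cp).Nonempty ∧ Cp ∩ (-Cp) = {0}

/-- `x ≤ y` iff `y - x ∈ C⁺`. -/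
def coneLe {n : ℕ} (Cp : Set (Euc n)) (x y : Euc n) : Prop := y - x ∈ Cp

/-- `x < y` iff `y - x ∈ C⁺ \ {0}`. -/
def coneLt {n : ℕ} (Cp : Set (Euc n)) (x y : Euc n) : Prop := y - x ∈ Cp ∧ y ≠ x

/-- `x ≪ y` iff `y - x ∈ Int C⁺`. -/
def coneLL {n : ℕ} (Cp : Set (Euc n)) (x y : Euc n) : Prop := y - x ∈ interior Cp

/-- `S` is unordered: no two distinct points related by `≤`. -/
def Unordered {n : ℕ} (Cp : Set (Euc n)) (S : Set (Euc n)) : Prop :=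
  ∀ x ∈ S, ∀ y ∈ S, x ≠ y → ¬ coneLe Cp x y

/-- (H1): `Φ` is strongly competitive. -/
def StronglyCompetitive {n : ℕ} (Φ : ℝ → Euc n → Euc n) (Cp : Set (Euc n)) : Prop :=
  ∀ t : ℝ, 0 < t → ∀ x y : Euc n,
    (coneLe Cp (Φ t x) (Φ t y) → coneLe Cp x y) ∧
    (coneLt Cp (Φ t x) (Φ t y) → coneLL Cp x y)

/-- `D` is invariant under the flow. -/
def Invariant {n : ℕ} (Φ : ℝ → Euc n → Euc n) (D : Set (Euc n)) : Prop :=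
  ∀ t : ℝ, Φ t '' D = D

/-- (H2): `Γ` is a compact invariant attractor uniformly attracting all compact sets. -/
def Dissipative {n : ℕ} (Φ : ℝ → Euc n → Euc n) (Γ : Set (Euc n)) : Prop :=
  Γ.Nonempty ∧ IsCompact Γ ∧ Invariant Φ Γ ∧
  ∀ N : Set (Euc n), IsCompact N → ∀ ε > 0, ∃ T : ℝ, ∀ t ≥ T, ∀ x ∈ N,
    Metric.infDist (Φ t x) Γ < ε

/-- The ω-limit set of `x`. -/
def omegaSet {n : ℕ} (Φ : ℝ → Euc n → Euc n) (x : Euc n) : Set (Euc n) :=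
  ⋂ t ∈ Ici (0 : ℝ), closure ((fun τ => Φ τ x) '' Ici t)

/-- The α-limit set of `x`. -/
def alphaSet {n : ℕ} (Φ : ℝ → Euc n → Euc n) (x : Euc n) : Set (Euc n) :=
  ⋂ t ∈ Iic (0 : ℝ), closure ((fun τ => Φ τ x) '' Iic t)

/-- The set `R(Φ)` of recurrent points. -/
def recurrentSet {n : ℕ} (Φ : ℝ → Euc n → Euc n) : Set (Euc n) :=
  {x | x ∈ omegaSet Φ x}

/-- The Birkhoff center `𝓑(Φ)`. -/
def birkhoffCenter {n : ℕ} (Φ : ℝ → Euc n → Euc n) : Set (Euc n) :=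
  closure (recurrentSet Φ)

/-- The set `E` of equilibria. -/
def equilibria {n : ℕ} (Φ : ℝ → Euc n → Euc n) : Set (Euc n) :=
  {p | ∀ t : ℝ, Φ t p = p}

/-- `C = C⁺ ∪ (−C⁺)`. -/
def coneC {n : ℕ} (Cp : Set (Euc n)) : Set (Euc n) := Cp ∪ (-Cp)

/-- `K = closure(ℝⁿ \ C)`. -/
def coneK {n : ℕ} (Cp : Set (Euc n)) : Set (Euc n) := closure ((coneC Cp)ᶜ)

/-- The translated cone `C_x = x + C`. -/
def coneCAt {n : ℕ} (Cp : Set (Euc n)) (x : Euc n) : Set (Euc n) := {y | y - x ∈ coneC Cp}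

/-- The translated complementary cone `K_x = x + K`. -/
def coneKAt {n : ℕ} (Cp : Set (Euc n)) (x : Euc n) : Set (Euc n) := {y | y - x ∈ coneK Cp}


/-- The support of a measure: complement of the union of open null sets. -/
def measSupport {n : ℕ} (μ : MeasureTheory.Measure (Euc n)) : Set (Euc n) :=
  {x | ∀ U : Set (Euc n), IsOpen U → x ∈ U → 0 < μ U}

theorem interior_neg_set {n : ℕ} (Cp : Set (Euc n)) : interior (-Cp) = -interior Cp :=
  ((Homeomorph.neg (Euc n)).preimage_interior Cp).symm

namespace IsConeOrder

variable {n : ℕ} {Cp : Set (Euc n)}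

theorem zero_mem (hC : IsConeOrder Cp) : (0 : Euc n) ∈ Cp := by
  have h : (0 : Euc n) ∈ Cp ∩ (-Cp) := by rw [hC.2.2.2.2]; rfl
  exact h.1

theorem eq_zero (hC : IsConeOrder Cp) {x : Euc n} (h : x ∈ Cp) (h' : -x ∈ Cp) : x = 0 := by
  have : x ∈ Cp ∩ (-Cp) := ⟨h, h'⟩
  rwa [hC.2.2.2.2] at this

theorem neg (hC : IsConeOrder Cp) : IsConeOrder (-Cp) := by
  obtain ⟨h1, h2, h3, h4, h5⟩ := hC
  refine ⟨h1.neg, fun x hx y hy => ?_, fun α hα x hx => ?_, ?_, ?_⟩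
  · have := h2 _ hx _ hy
    rw [Set.mem_neg]
    rwa [neg_add]
  · have := h3 α hα _ hx
    rw [Set.mem_neg]
    rwa [← smul_neg]
  · rw [interior_neg_set]
    exact h4.neg
  · rw [neg_neg, Set.inter_comm, h5]

/-- Every interior point of the cone is an order unit. -/
theorem exists_ball_subset (hC : IsConeOrder Cp) {e : Euc n} (he : e ∈ interior Cp) :
    ∃ δ > 0, ∀ r : ℝ, 0 < r → ∀ v : Euc n, ‖v‖ < r * δ → r • e + v ∈ interior Cp := by
  obtain ⟨δ, hδ, hball⟩ := Metric.isOpen_iff.1 isOpen_interior e he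
  refine ⟨δ, hδ, fun r hr v hv => ?_⟩
  have hsub : Metric.ball (r • e) (r * δ) ⊆ Cp := by
    intro w hw
    have h1 : r⁻¹ • w ∈ Metric.ball e δ := by
      rw [Metric.mem_ball, dist_eq_norm] at hw ⊢
      have : r⁻¹ • w - e = r⁻¹ • (w - r • e) := by
        rw [smul_sub, smul_smul, inv_mul_cancel₀ hr.ne', one_smul]
      rw [this, norm_smul, Real.norm_of_nonneg (inv_nonneg.2 hr.le), inv_mul_lt_iff₀ hr]
      exact hw
    have h2 := hC.2.2.1 r hr _ (interior_subset (hball h1))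
    rwa [smul_smul, mul_inv_cancel₀ hr.ne', one_smul] at h2
  refine interior_maximal hsub Metric.isOpen_ball ?_
  simpa [dist_eq_norm] using hv

theorem smul_mem_interior (hC : IsConeOrder Cp) {e : Euc n} (he : e ∈ interior Cp) {r : ℝ}
    (hr : 0 < r) : r • e ∈ interior Cp := by
  obtain ⟨δ, hδ, h⟩ := hC.exists_ball_subset he
  simpa using h r hr 0 (by simpa using mul_pos hr hδ)

theorem ne_zero_of_mem_interior (hC : IsConeOrder Cp) (hn : 0 < n) {e : Euc n}
    (he : e ∈ interior Cp) : e ≠ 0 := by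
  rintro rfl
  obtain ⟨δ, hδ, h⟩ := hC.exists_ball_subset he
  have hmem : ∀ v : Euc n, v ∈ Cp := fun v => by
    have := h ((‖v‖ + 1) / δ) (by positivity) v (by
      rw [div_mul_cancel₀ _ hδ.ne']; linarith)
    simpa using interior_subset this
  have : Nonempty (Fin n) := ⟨⟨0, hn⟩⟩
  obtain ⟨v, hv⟩ := exists_ne (0 : Euc n)
  exact hv (hC.eq_zero (hmem _) (hmem _))

theorem add_mem_interior (hC : IsConeOrder Cp) {x y : Euc n} (hx : x ∈ interior Cp)
    (hy : y ∈ Cp) : x + y ∈ interior Cp := by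
  have hsub : (fun z => z - y) ⁻¹' interior Cp ⊆ Cp := fun z hz => by
    have := hC.2.1 _ (interior_subset hz) _ hy
    simpa using this
  refine interior_maximal hsub (isOpen_interior.preimage (by fun_prop)) ?_
  simpa using hx

end IsConeOrder

section Hypersurface

variable {n : ℕ} {Cp U : Set (Euc n)} {e : Euc n}

/-- The frontier of an upper set crossing every line in direction `e` is the zero set of a
continuous height function. -/
theorem exists_height (hC : IsConeOrder Cp) (he : e ∈ interior Cp)
    (hU : ∀ y ∈ U, ∀ c ∈ Cp, y + c ∈ U) (hin : ∀ v : Euc n, ∃ s : ℝ, v + s • e ∈ U)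
    (hout : ∀ v : Euc n, ∃ s : ℝ, v + s • e ∉ U) :
    ∃ h : Euc n → ℝ, Continuous h ∧ (∀ v r, h (v + r • e) = h v - r) ∧
      (∀ v, ∀ c ∈ Cp, h (v + c) ≤ h v) ∧ frontier U = {v | h v = 0} := by
  have hup : ∀ (v : Euc n) (s s' : ℝ), s ≤ s' → v + s • e ∈ U → v + s' • e ∈ U := by
    intro v s s' hs hv
    rcases hs.eq_or_lt with rfl | hs
    · exact hv
    have := hU _ hv _ (hC.2.2.1 (s' - s) (sub_pos.2 hs) e (interior_subset he))
    convert this using 1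
    module
  have hbdd : ∀ v : Euc n, BddBelow {s : ℝ | v + s • e ∈ U} := fun v => by
    obtain ⟨s₀, hs₀⟩ := hout v
    exact ⟨s₀, fun s hs => le_of_not_gt fun hlt => hs₀ (hup v s s₀ hlt.le hs)⟩
  obtain ⟨h, hle, hlt⟩ : ∃ h : Euc n → ℝ, (∀ v s, v + s • e ∈ U → h v ≤ s) ∧
      ∀ v s, h v < s → v + s • e ∈ U := by
    refine ⟨fun v => sInf {s : ℝ | v + s • e ∈ U}, fun v s hs => csInf_le (hbdd v) hs,
      fun v s hs => ?_⟩
    obtain ⟨s', hs', hlt⟩ := (csInf_lt_iff (hbdd v) (hin v)).1 hs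
    exact hup v s' s hlt.le hs'
  have htr' : ∀ v r, h (v + r • e) ≤ h v - r := by
    intro v r
    refine le_of_forall_gt_imp_ge_of_dense fun s hs => hle _ _ ?_
    have := hlt v (r + s) (by linarith)
    rwa [add_smul, ← add_assoc] at this
  have htr : ∀ v r, h (v + r • e) = h v - r := by
    intro v r
    refine le_antisymm (htr' v r) ?_
    have := htr' (v + r • e) (-r)
    rw [neg_smul, add_neg_cancel_right] at this
    linarith
  have hmono : ∀ v, ∀ c ∈ Cp, h (v + c) ≤ h v := by
    intro v c hc
    refine le_of_forall_gt_imp_ge_of_dense fun s hs => hle _ _ ?_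
    have := hU _ (hlt v s hs) c hc
    rwa [add_right_comm] at this
  have hcont : Continuous h := by
    obtain ⟨δ, hδ, hball⟩ := hC.exists_ball_subset he
    have key : ∀ r : ℝ, 0 < r → ∀ v w : Euc n, ‖w - v‖ < r * δ → h w ≤ h v + r := by
      intro r hr v w hvw
      have h1 := hmono v _ (interior_subset (hball r hr _ hvw))
      have h2 : v + (r • e + (w - v)) = w + r • e := by abel
      rw [h2, htr] at h1
      linarith
    refine Metric.continuous_iff.2 fun v ε hε => ⟨ε / 2 * δ, by positivity, fun w hw => ?_⟩
    rw [dist_eq_norm] at hw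
    have h1 := key (ε / 2) (by positivity) v w hw
    have h2 := key (ε / 2) (by positivity) w v (by rwa [norm_sub_rev])
    rw [Real.dist_eq, abs_lt]
    constructor <;> linarith
  refine ⟨h, hcont, htr, hmono, ?_⟩
  have hneg : {v | h v < 0} ⊆ interior U :=
    interior_maximal (fun v hv => by simpa using hlt v 0 hv) (isOpen_lt hcont continuous_const)
  have hpos : {v | 0 < h v} ⊆ interior Uᶜ :=
    interior_maximal (fun v hv hvU => not_le.2 hv (hle v 0 (by simpa using hvU)))
      (isOpen_lt continuous_const hcont)
  have hlim : ∀ (v : Euc n) (c : ℝ), Tendsto (fun r : ℝ => v + (c * r) • e) (𝓝[>] 0) (𝓝 v) := by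
    intro v c
    have : Continuous fun r : ℝ => v + (c * r) • e := by fun_prop
    simpa using (this.tendsto 0).mono_left nhdsWithin_le_nhds
  ext v
  constructor
  · intro hv
    rw [frontier_eq_closure_inter_closure, closure_compl] at hv
    refine le_antisymm (not_lt.1 fun hp => ?_) (not_lt.1 fun hp => hv.2 (hneg hp))
    have := hpos hp
    rw [interior_compl] at this
    exact this hv.1
  · intro hv
    have hv : h v = 0 := hv
    rw [frontier_eq_closure_inter_closure]
    constructor
    · refine mem_closure_of_tendsto (hlim v 1) ?_
      filter_upwards [self_mem_nhdsWithin] with r hr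
      exact hlt v _ (by rw [hv, one_mul]; exact hr)
    · refine mem_closure_of_tendsto (hlim v (-1)) ?_
      filter_upwards [self_mem_nhdsWithin] with r hr hmem
      have := hle v _ hmem
      have hr : (0 : ℝ) < r := hr
      linarith

/-- A level set of a continuous function that is affine of slope `-1` in direction `e` is
homeomorphic to the hyperplane orthogonal to `e`. -/
theorem nonempty_homeomorph_of_height {h : Euc n → ℝ} (hcont : Continuous h)
    (htr : ∀ v r, h (v + r • e) = h v - r) (he : e ≠ 0) :
    Nonempty ({v | h v = 0} ≃ₜ Euc (n - 1)) := by
  have hfin : Module.finrank ℝ (ℝ ∙ e)ᗮ = n - 1 := by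
    have h1 := (ℝ ∙ e).finrank_add_finrank_orthogonal
    rw [finrank_span_singleton he, finrank_euclideanSpace_fin] at h1
    omega
  have hpe : (ℝ ∙ e)ᗮ.orthogonalProjectionOnto e = 0 :=
    Submodule.orthogonalProjectionOnto_orthogonal_apply_eq_zero (Submodule.mem_span_singleton_self e)
  have hdec : ∀ v : Euc n, ∃ r : ℝ,
      v = ((ℝ ∙ e)ᗮ.orthogonalProjectionOnto v : Euc n) + r • e := by
    intro v
    obtain ⟨r, hr⟩ := Submodule.mem_span_singleton.1
      ((ℝ ∙ e).starProjection_apply_mem v)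
    refine ⟨r, ?_⟩
    rw [hr]
    have := (ℝ ∙ e).starProjection_add_starProjection_orthogonal v
    rw [add_comm] at this
    exact this.symm
  let φ : {v | h v = 0} ≃ₜ (ℝ ∙ e)ᗮ :=
    { toFun := fun v => (ℝ ∙ e)ᗮ.orthogonalProjectionOnto v
      invFun := fun w => ⟨(w : Euc n) + h w • e, by simp [htr]⟩
      left_inv := by
        rintro ⟨v, hv⟩
        obtain ⟨r, hr⟩ := hdec v
        have hv : h v = 0 := hv
        rw [hr, htr] at hv
        refine Subtype.ext ?_
        change _ + h _ • e = v
        rw [sub_eq_zero.1 hv]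
        exact hr.symm
      right_inv := fun w => by
        simp [hpe]
      continuous_toFun := by fun_prop
      continuous_invFun := by
        refine Continuous.subtype_mk ?_ _
        fun_prop }
  exact ⟨φ.trans ((stdOrthonormalBasis ℝ (ℝ ∙ e)ᗮ).repr.toHomeomorph.trans
    (LinearIsometryEquiv.piLpCongrLeft 2 ℝ ℝ (finCongr hfin)).toHomeomorph)⟩

end Hypersurface

section Flow

variable {n : ℕ} {Φ : ℝ → Euc n → Euc n} {Cp : Set (Euc n)}

theorem IsFlow.continuous (hΦ : IsFlow Φ) (t : ℝ) : Continuous (Φ t) :=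
  hΦ.1.comp (by fun_prop : Continuous fun x : Euc n => (t, x))

theorem IsFlow.neg_apply (hΦ : IsFlow Φ) (t : ℝ) (x : Euc n) : Φ (-t) (Φ t x) = x := by
  rw [hΦ.2.2, neg_add_cancel, hΦ.2.1]

theorem IsFlow.apply_neg (hΦ : IsFlow Φ) (t : ℝ) (x : Euc n) : Φ t (Φ (-t) x) = x := by
  rw [hΦ.2.2, add_neg_cancel, hΦ.2.1]

theorem IsFlow.injective (hΦ : IsFlow Φ) (t : ℝ) : Function.Injective (Φ t) :=
  Function.LeftInverse.injective (hΦ.neg_apply t)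

/-- The time-`t` map of a flow as a homeomorphism. -/
def IsFlow.homeomorph (hΦ : IsFlow Φ) (t : ℝ) : Euc n ≃ₜ Euc n where
  toFun := Φ t
  invFun := Φ (-t)
  left_inv := hΦ.neg_apply t
  right_inv := hΦ.apply_neg t
  continuous_toFun := hΦ.continuous t
  continuous_invFun := hΦ.continuous (-t)

theorem IsFlow.invariant_of_forall_mem (hΦ : IsFlow Φ) {D : Set (Euc n)}
    (hD : ∀ t, ∀ x ∈ D, Φ t x ∈ D) : Invariant Φ D := fun t =>
  Subset.antisymm (image_subset_iff.2 (hD t)) fun x hx => ⟨Φ (-t) x, hD _ x hx, hΦ.apply_neg t x⟩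

theorem Invariant.apply_mem {D : Set (Euc n)} (hD : Invariant Φ D) (t : ℝ) {x : Euc n}
    (hx : x ∈ D) : Φ t x ∈ D := by
  rw [← hD t]
  exact mem_image_of_mem _ hx

theorem StronglyCompetitive.neg (h : StronglyCompetitive Φ Cp) : StronglyCompetitive Φ (-Cp) := by
  intro t ht x y
  obtain ⟨h1, h2⟩ := h t ht y x
  simp only [coneLe, coneLt, coneLL, interior_neg_set, Set.mem_neg, neg_sub] at h1 h2 ⊢
  exact ⟨h1, fun hxy => h2 ⟨hxy.1, hxy.2.symm⟩⟩

theorem StronglyCompetitive.sub_mem_of_neg (h : StronglyCompetitive Φ Cp) (hΦ : IsFlow Φ) {t : ℝ}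
    (ht : t < 0) {x y : Euc n} (hxy : y - x ∈ Cp) : Φ t y - Φ t x ∈ Cp := by
  refine (h (-t) (neg_pos.2 ht) (Φ t x) (Φ t y)).1 ?_
  rwa [coneLe, hΦ.neg_apply, hΦ.neg_apply]

theorem StronglyCompetitive.sub_mem_interior_of_neg (h : StronglyCompetitive Φ Cp)
    (hΦ : IsFlow Φ) {t : ℝ} (ht : t < 0) {x y : Euc n} (hxy : y - x ∈ Cp) (hne : y ≠ x) :
    Φ t y - Φ t x ∈ interior Cp := by
  refine (h (-t) (neg_pos.2 ht) (Φ t x) (Φ t y)).2 ?_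
  rw [coneLt, hΦ.neg_apply, hΦ.neg_apply]
  exact ⟨hxy, hne⟩

/-- A bounded invariant unordered set extends to an invariant unordered hypersurface. -/
theorem exists_invariant_unordered_hypersurface (hn : 0 < n) (hΦ : IsFlow Φ)
    (hC : IsConeOrder Cp) (hcomp : StronglyCompetitive Φ Cp) {B : Set (Euc n)}
    (hne : B.Nonempty) (hbd : Bornology.IsBounded B) (hinv : Invariant Φ B)
    (hun : Unordered Cp B) :
    ∃ M : Set (Euc n), Invariant Φ M ∧ Unordered Cp M ∧ Nonempty (↥M ≃ₜ Euc (n - 1)) ∧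
      B ⊆ M := by
  obtain ⟨e, he⟩ := hC.2.2.2.1
  have he0 := hC.ne_zero_of_mem_interior hn he
  have heC := interior_subset he
  obtain ⟨δ, hδ, hball⟩ := hC.exists_ball_subset he
  obtain ⟨R, hR⟩ := hbd.exists_norm_le
  have hbig : ∀ v : Euc n, ∃ r : ℝ, 0 < r ∧ ∀ b ∈ B, r • e + (b - v) ∈ interior Cp ∧
      r • e + (v - b) ∈ interior Cp := by
    intro v
    refine ⟨(|R| + ‖v‖ + 1) / δ, by positivity, fun b hb => ?_⟩
    have h1 : ‖b - v‖ < (|R| + ‖v‖ + 1) / δ * δ := by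
      rw [div_mul_cancel₀ _ hδ.ne']
      have := norm_sub_le b v
      have := hR b hb
      have := le_abs_self R
      linarith
    exact ⟨hball _ (by positivity) _ h1, hball _ (by positivity) _ (by rwa [norm_sub_rev])⟩
  set U : Set (Euc n) := {y | ∃ t : ℝ, ∃ b ∈ B, Φ t y - b ∈ Cp}
  have hUneg : ∀ y ∈ U, ∃ t < 0, ∃ b ∈ B, Φ t y - b ∈ Cp := by
    rintro y ⟨t, b, hb, hy⟩
    have hr : -(|t| + 1) < 0 := by linarith [abs_nonneg t]
    refine ⟨-(|t| + 1) + t, by linarith [le_abs_self t], _,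
      hinv.apply_mem (-(|t| + 1)) hb, ?_⟩
    rw [← hΦ.2.2]
    exact hcomp.sub_mem_of_neg hΦ hr hy
  have hUup : ∀ y ∈ U, ∀ c ∈ Cp, y + c ∈ U := by
    intro y hy c hc
    obtain ⟨t, ht, b, hb, hyb⟩ := hUneg y hy
    have h1 : Φ t (y + c) - Φ t y ∈ Cp := hcomp.sub_mem_of_neg hΦ ht (by simpa using hc)
    refine ⟨t, b, hb, ?_⟩
    simpa using hC.2.1 _ h1 _ hyb
  have hUB : ∀ b ∈ B, b ∈ U := fun b hb =>
    ⟨0, b, hb, by rw [hΦ.2.1, sub_self]; exact hC.zero_mem⟩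
  have hUin : ∀ v : Euc n, ∃ s : ℝ, v + s • e ∈ U := by
    intro v
    obtain ⟨r, -, hr⟩ := hbig v
    obtain ⟨b, hb⟩ := hne
    have := hUup b (hUB b hb) _ (interior_subset (hr b hb).2)
    refine ⟨r, ?_⟩
    convert this using 1
    abel
  have hUout : ∀ v : Euc n, ∃ s : ℝ, v + s • e ∉ U := by
    intro v
    obtain ⟨r, -, hr⟩ := hbig v
    refine ⟨-r, fun hmem => ?_⟩
    obtain ⟨t, ht, b, hb, hvb⟩ := hUneg _ hmem
    have h0 := (hr _ (hinv.apply_mem (-t) hb)).1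
    have h1 : Φ (-t) b - (v + -r • e) ∈ interior Cp := by
      convert h0 using 1
      module
    have h2 := hcomp.sub_mem_of_neg hΦ ht (interior_subset h1)
    rw [hΦ.apply_neg] at h2
    have h3 := sub_eq_zero.1 (hC.eq_zero h2 (by rwa [neg_sub]))
    rw [← hΦ.apply_neg t b] at h3
    have h4 := hΦ.injective t h3
    rw [h4, sub_self] at h1
    exact hC.ne_zero_of_mem_interior hn h1 rfl
  obtain ⟨h, hcont, htr, hmono, hfr⟩ := exists_height hC he hUup hUin hUout
  have hUinv : Invariant Φ U := hΦ.invariant_of_forall_mem fun t y => by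
    rintro ⟨s, b, hb, hy⟩
    refine ⟨s - t, b, hb, ?_⟩
    rwa [hΦ.2.2, sub_add_cancel]
  have hMinv : Invariant Φ (frontier U) := fun t => by
    have := (hΦ.homeomorph t).image_frontier U
    change Φ t '' frontier U = frontier (Φ t '' U) at this
    rw [this, hUinv t]
  refine ⟨frontier U, hMinv, ?_, ?_, ?_⟩
  · intro x hx y hy hxy hle
    have h1 := hcomp.sub_mem_interior_of_neg hΦ (t := -1) (by norm_num) hle hxy.symm
    have hx' := hMinv.apply_mem (-1) hx
    have hy' := hMinv.apply_mem (-1) hy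
    generalize Φ (-1) x = x' at h1 hx'
    generalize Φ (-1) y = y' at h1 hy'
    rw [hfr] at hx' hy'
    have hx' : h x' = 0 := hx'
    have hy' : h y' = 0 := hy'
    have hlim : Tendsto (fun r : ℝ => y' - x' - r • e) (𝓝[>] 0) (𝓝 (y' - x')) := by
      have : Continuous fun r : ℝ => y' - x' - r • e := by fun_prop
      simpa using (this.tendsto 0).mono_left nhdsWithin_le_nhds
    obtain ⟨r, hr, hr0⟩ := ((hlim.eventually (isOpen_interior.mem_nhds h1)).and
      self_mem_nhdsWithin).exists
    have h2 := hmono x' _ (interior_subset hr)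
    have h3 : x' + (y' - x' - r • e) = y' + (-r) • e := by module
    rw [h3, htr, hx', hy'] at h2
    have hr0 : (0 : ℝ) < r := hr0
    linarith
  · rw [hfr]
    exact nonempty_homeomorph_of_height hcont htr he0
  · intro b hb
    rw [frontier_eq_closure_inter_closure]
    refine ⟨subset_closure (hUB b hb), ?_⟩
    have hlim : Tendsto (fun r : ℝ => b - r • e) (𝓝[>] 0) (𝓝 b) := by
      have : Continuous fun r : ℝ => b - r • e := by fun_prop
      simpa using (this.tendsto 0).mono_left nhdsWithin_le_nhds
    refine mem_closure_of_tendsto hlim ?_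
    filter_upwards [self_mem_nhdsWithin] with r hr hmem
    have hr : (0 : ℝ) < r := hr
    obtain ⟨t, ht, b', hb', hbb'⟩ := hUneg _ hmem
    have h1 : Φ t b - Φ t (b - r • e) ∈ Cp :=
      hcomp.sub_mem_of_neg hΦ ht (by simpa using hC.2.2.1 r hr e heC)
    have h2 : Φ t b - b' ∈ Cp := by simpa using hC.2.1 _ h1 _ hbb'
    have h3 : b' = Φ t b := by
      by_contra hne'
      exact hun b' hb' _ (hinv.apply_mem t hb) hne' h2
    rw [h3] at hbb'
    have h4 := hΦ.injective t (sub_eq_zero.1 (hC.eq_zero h1 (by rwa [neg_sub])))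
    have h5 : r • e = 0 := sub_eq_self.1 h4.symm
    exact (smul_ne_zero hr.ne' he0) h5

end Flow

section Order

variable {n : ℕ} {Cp B : Set (Euc n)}

/-- If comparable distinct points of a preconnected set are strongly ordered, a point of it that
is incomparable to some point lies below no other point. -/
theorem IsPreconnected.not_le_of_incomparable (hC : IsConeOrder Cp) (hB : IsPreconnected B)
    (hS : ∀ x ∈ B, ∀ y ∈ B, x ≠ y → y - x ∈ Cp → y - x ∈ interior Cp)
    {x w : Euc n} (hx : x ∈ B) (hw : w ∈ B) (hxw : w - x ∉ Cp) (hwx : x - w ∉ Cp)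
    {y : Euc n} (hy : y ∈ B) (hxy : y ≠ x) : y - x ∉ Cp := by
  intro hle
  have hll := hS x hx y hy hxy.symm hle
  have hclopen : ∀ A : Set (Euc n), ∀ O F : Set (Euc n), IsOpen O → IsClosed F →
      B ∩ O = A → B ∩ F = A → A.Nonempty → B ⊆ A := by
    intro A O F hO hF hBO hBF hA
    have h1 := hB O Fᶜ hO hF.isOpen_compl (fun z hz => by
      by_cases hzF : z ∈ F
      · left
        have : z ∈ B ∩ O := by rw [hBO, ← hBF]; exact ⟨hz, hzF⟩
        exact this.2
      · exact Or.inr hzF) (by rwa [hBO])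
    by_contra hBA
    obtain ⟨z, hz, hzA⟩ := not_subset.1 hBA
    obtain ⟨u, hu, huO, huF⟩ := h1 ⟨z, hz, fun hzF => hzA (hBF ▸ ⟨hz, hzF⟩)⟩
    have : u ∈ B ∩ F := by rw [hBF, ← hBO]; exact ⟨hu, huO⟩
    exact huF this.2
  have hlow : ∀ z : Euc n, IsClosed {v | v - z ∈ Cp} := fun z => hC.1.preimage (by fun_prop)
  have hupp : ∀ z : Euc n, IsClosed {v | z - v ∈ Cp} := fun z => hC.1.preimage (by fun_prop)
  have hlow' : ∀ z : Euc n, IsOpen {v | v - z ∈ interior Cp} := fun z =>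
    isOpen_interior.preimage (by fun_prop)
  have hupp' : ∀ z : Euc n, IsOpen {v | z - v ∈ interior Cp} := fun z =>
    isOpen_interior.preimage (by fun_prop)
  obtain ⟨w', hw', hxw', hwx', hyw'⟩ :
      ∃ w' ∈ B, w' - x ∉ Cp ∧ x - w' ∉ Cp ∧ y - w' ∈ interior Cp := by
    by_contra! hcon
    have := hclopen {v ∈ B | v - x ∉ Cp ∧ x - v ∉ Cp}
      ({v | v - x ∈ Cp} ∪ {v | x - v ∈ Cp})ᶜ
      (({v | v - x ∈ interior Cp} ∪ {v | x - v ∈ interior Cp}) ∪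
        {v | y - v ∈ interior Cp})ᶜ
      ((hlow x).union (hupp x)).isOpen_compl
      (((hlow' x).union (hupp' x)).union (hupp' y)).isClosed_compl
      (by ext v; simp only [mem_inter_iff, mem_compl_iff, mem_union, mem_ofPred_eq, not_or]) (by
        ext v
        simp only [mem_inter_iff, mem_compl_iff, mem_union, mem_ofPred_eq, not_or]
        constructor
        · rintro ⟨hv, ⟨h1, h2⟩, h3⟩
          have hne : v ≠ x := by rintro rfl; exact h3 hll
          exact ⟨hv, fun h => h1 (hS x hx v hv hne.symm h), fun h => h2 (hS v hv x hx hne h)⟩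
        · rintro ⟨hv, h1, h2⟩
          exact ⟨hv, ⟨fun h => h1 (interior_subset h), fun h => h2 (interior_subset h)⟩,
            hcon v hv h1 h2⟩) ⟨w, hw, hxw, hwx⟩
    exact (this hx).2.1 (by rw [sub_self]; exact hC.zero_mem)
  have := hclopen {v ∈ B | v - x ∈ Cp ∧ v - w' ∈ Cp}
    ({v | v - x ∈ interior Cp} ∩ {v | v - w' ∈ interior Cp})
    ({v | v - x ∈ Cp} ∩ {v | v - w' ∈ Cp})
    ((hlow' x).inter (hlow' w')) ((hlow x).inter (hlow w'))
    (by
      ext v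
      simp only [mem_inter_iff, mem_ofPred_eq]
      constructor
      · rintro ⟨hv, h1, h2⟩
        exact ⟨hv, interior_subset h1, interior_subset h2⟩
      · rintro ⟨hv, h1, h2⟩
        refine ⟨hv, hS x hx v hv ?_ h1, hS w' hw' v hv ?_ h2⟩
        · rintro rfl; exact hwx' h2
        · rintro rfl; exact hxw' h1) rfl ⟨y, hy, hle, interior_subset hyw'⟩
  exact hwx' (this hx).2.2

end Order

section Support

open MeasureTheory

variable {n : ℕ} {Φ : ℝ → Euc n → Euc n} {Cp Γ : Set (Euc n)} {μ : Measure (Euc n)}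

theorem isClosed_measSupport : IsClosed (measSupport μ) := by
  refine isOpen_compl_iff.1 (isOpen_iff_mem_nhds.2 fun x hx => ?_)
  simp only [measSupport, mem_compl_iff, mem_ofPred_eq, not_forall] at hx
  obtain ⟨U, hU, hxU, hμ⟩ := hx
  filter_upwards [hU.mem_nhds hxU] with y hy hyS
  exact hμ (hyS U hU hy)

theorem prod_pos_of_mem_measSupport [SFinite μ] {x y : Euc n} (hx : x ∈ measSupport μ)
    (hy : y ∈ measSupport μ) {O : Set (Euc n × Euc n)} (hO : IsOpen O) (hxy : (x, y) ∈ O) :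
    0 < (μ.prod μ) O := by
  obtain ⟨U, V, hU, hV, hxU, hyV, hUV⟩ := isOpen_prod_iff.1 hO x y hxy
  refine lt_of_lt_of_le ?_ (measure_mono hUV)
  rw [Measure.prod_prod]
  exact ENNReal.mul_pos (hx U hU hxU).ne' (hy V hV hyV).ne'

theorem invariant_measSupport (hΦ : IsFlow Φ)
    (hμ : ∀ t : ℝ, MeasurePreserving (Φ t) μ μ) : Invariant Φ (measSupport μ) :=
  hΦ.invariant_of_forall_mem fun t x hx U hU hxU => by
    rw [← (hμ t).measure_preimage hU.measurableSet.nullMeasurableSet]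
    exact hx _ (hU.preimage (hΦ.continuous t)) hxU

theorem isBounded_measSupport [IsFiniteMeasure μ] (hΓ : Dissipative Φ Γ)
    (hμ : ∀ t : ℝ, MeasurePreserving (Φ t) μ μ) : Bornology.IsBounded (measSupport μ) := by
  obtain ⟨hne, hcpt, -, hattr⟩ := hΓ
  refine (hcpt.isBounded.cthickening (δ := 1)).subset fun x hx => ?_
  have hmeas : MeasurableSet (cthickening 1 Γ) := isClosed_cthickening.measurableSet
  have hle : ∀ k : ℕ, μ (closedBall 0 k) ≤ μ (cthickening 1 Γ) := by
    intro k
    obtain ⟨T, hT⟩ := hattr _ (isCompact_closedBall (0 : Euc n) k) 1 one_pos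
    rw [← (hμ T).measure_preimage hmeas.nullMeasurableSet]
    refine measure_mono fun z hz => ?_
    exact thickening_subset_cthickening 1 Γ
      ((mem_thickening_iff_infDist_lt hne).2 (hT T le_rfl z hz))
  have htop : μ univ ≤ μ (cthickening 1 Γ) := by
    rw [← iUnion_closedBall_nat (0 : Euc n)]
    rw [(monotone_nat_of_le_succ fun k => closedBall_subset_closedBall
      (by push_cast; linarith)).measure_iUnion]
    exact iSup_le hle
  have hnull : μ (cthickening 1 Γ)ᶜ = 0 := by
    rw [measure_compl hmeas (measure_ne_top _ _)]
    exact tsub_eq_zero_of_le htop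
  by_contra hxΓ
  exact (hx _ isClosed_cthickening.isOpen_compl hxΓ).ne' hnull

/-- On the support of an invariant measure the strong order is preserved in forward time. -/
theorem sub_mem_of_mem_measSupport [IsFiniteMeasure μ] (hΦ : IsFlow Φ) (hC : IsConeOrder Cp)
    (hcomp : StronglyCompetitive Φ Cp) (hμ : ∀ t : ℝ, MeasurePreserving (Φ t) μ μ)
    {x y : Euc n} (hx : x ∈ measSupport μ) (hy : y ∈ measSupport μ) {t : ℝ} (ht : 0 < t)
    (hxy : y - x ∈ interior Cp) : Φ t y - Φ t x ∈ Cp := by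
  set Q : Set (Euc n × Euc n) := {p | p.2 - p.1 ∈ Cp}
  have hQ : IsClosed Q := hC.1.preimage (by fun_prop)
  have hcont : Continuous (Prod.map (Φ t) (Φ t)) := (hΦ.continuous t).prodMap (hΦ.continuous t)
  have hT : MeasurePreserving (Prod.map (Φ t) (Φ t)) (μ.prod μ) (μ.prod μ) := (hμ t).prod (hμ t)
  have hsub : Prod.map (Φ t) (Φ t) ⁻¹' Q ⊆ Q := fun p hp => (hcomp t ht p.1 p.2).1 hp
  have hnull : (μ.prod μ) (Q \ Prod.map (Φ t) (Φ t) ⁻¹' Q) = 0 := by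
    rw [measure_sdiff hsub (hQ.preimage hcont).measurableSet.nullMeasurableSet
      (measure_ne_top _ _), hT.measure_preimage hQ.measurableSet.nullMeasurableSet, tsub_self]
  by_contra hcon
  have hopen : IsOpen ({p : Euc n × Euc n | p.2 - p.1 ∈ interior Cp} \
      Prod.map (Φ t) (Φ t) ⁻¹' Q) :=
    (isOpen_interior.preimage (by fun_prop)).sdiff (hQ.preimage hcont)
  have hpos := prod_pos_of_mem_measSupport hx hy hopen ⟨hxy, hcon⟩
  refine hpos.ne' (measure_mono_null ?_ hnull)
  exact sdiff_subset_sdiff_left fun p (hp : p.2 - p.1 ∈ interior Cp) =>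
    (interior_subset hp : p.2 - p.1 ∈ Cp)

theorem sub_mem_interior_of_mem_measSupport [IsFiniteMeasure μ] (hΦ : IsFlow Φ)
    (hC : IsConeOrder Cp) (hcomp : StronglyCompetitive Φ Cp)
    (hμ : ∀ t : ℝ, MeasurePreserving (Φ t) μ μ) {x y : Euc n} (hx : x ∈ measSupport μ)
    (hy : y ∈ measSupport μ) (hne : x ≠ y) (hxy : y - x ∈ Cp) : y - x ∈ interior Cp := by
  have hS := invariant_measSupport hΦ hμ
  have h1 := hcomp.sub_mem_interior_of_neg hΦ (t := -1) (by norm_num) hxy hne.symm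
  have h2 := sub_mem_of_mem_measSupport hΦ hC hcomp hμ (hS.apply_mem (-1) hx)
    (hS.apply_mem (-1) hy) (t := 2) two_pos h1
  rw [hΦ.2.2, hΦ.2.2] at h2
  norm_num at h2
  exact (hcomp 1 one_pos x y).2 ⟨h2, fun h => hne (hΦ.injective 1 h).symm⟩

/-- No point of the support of an invariant measure is strictly below a past state of itself. -/
theorem eq_of_le_past [IsFiniteMeasure μ] (hn : 0 < n) (hΦ : IsFlow Φ) (hC : IsConeOrder Cp)
    (hcomp : StronglyCompetitive Φ Cp) (hμ : ∀ t : ℝ, MeasurePreserving (Φ t) μ μ)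
    {x : Euc n} (hx : x ∈ measSupport μ) {s : ℝ} (hs : s < 0) (hle : Φ s x - x ∈ Cp) :
    Φ s x = x := by
  by_contra hne
  have hll := sub_mem_interior_of_mem_measSupport hΦ hC hcomp hμ hx
    ((invariant_measSupport hΦ hμ).apply_mem s hx) (Ne.symm hne) hle
  have hopen : IsOpen {p : Euc n × Euc n | Φ s p.2 - p.1 ∈ interior Cp} :=
    isOpen_interior.preimage (((hΦ.continuous s).comp continuous_snd).sub continuous_fst)
  obtain ⟨U, V, hU, hV, hxU, hxV, hUV⟩ := isOpen_prod_iff.1 hopen x x hll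
  have hW : IsOpen (U ∩ V) := hU.inter hV
  obtain ⟨w, hw, m, hm, hmw⟩ := (hμ s).conservative.exists_mem_iterate_mem
    hW.measurableSet.nullMeasurableSet (hx _ hW ⟨hxU, hxV⟩).ne'
  have hiter : ∀ k : ℕ, (Φ s)^[k + 1] w - Φ s w ∈ Cp := by
    intro k
    induction k with
    | zero => simpa using hC.zero_mem
    | succ k ih =>
      have h1 := interior_subset (hUV (show (w, w) ∈ U ×ˢ V from ⟨hw.1, hw.2⟩))
      have h2 : (Φ s)^[k + 1] w - w ∈ Cp := by simpa using hC.2.1 _ ih _ h1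
      rw [Function.iterate_succ_apply']
      exact hcomp.sub_mem_of_neg hΦ hs h2
  obtain ⟨k, rfl⟩ := Nat.exists_eq_succ_of_ne_zero hm
  have h1 : Φ s w - (Φ s)^[k + 1] w ∈ interior Cp :=
    hUV (show ((Φ s)^[k + 1] w, w) ∈ U ×ˢ V from ⟨hmw.1, hw.2⟩)
  have h2 := hC.eq_zero (hiter k) (by rw [neg_sub]; exact interior_subset h1)
  rw [sub_eq_zero.1 h2, sub_self] at h1
  exact hC.ne_zero_of_mem_interior hn h1 rfl

theorem eq_of_comparable_orbit [IsFiniteMeasure μ] (hn : 0 < n) (hΦ : IsFlow Φ)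
    (hC : IsConeOrder Cp) (hcomp : StronglyCompetitive Φ Cp)
    (hμ : ∀ t : ℝ, MeasurePreserving (Φ t) μ μ) {x : Euc n} (hx : x ∈ measSupport μ) {s : ℝ}
    (h : Φ s x - x ∈ Cp ∨ x - Φ s x ∈ Cp) : Φ s x = x := by
  have key : ∀ y ∈ measSupport μ, ∀ r < 0, (Φ r y - y ∈ Cp ∨ y - Φ r y ∈ Cp) → Φ r y = y := by
    rintro y hy r hr (h | h)
    · exact eq_of_le_past hn hΦ hC hcomp hμ hy hr h
    · exact eq_of_le_past hn hΦ hC.neg hcomp.neg hμ hy hr (by rwa [Set.mem_neg, neg_sub])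
  rcases lt_trichotomy s 0 with hs | rfl | hs
  · exact key x hx s hs h
  · exact hΦ.2.1 x
  · have := key (Φ s x) ((invariant_measSupport hΦ hμ).apply_mem s hx) (-s) (neg_neg_of_pos hs)
    rw [hΦ.neg_apply] at this
    exact (this h.symm).symm

theorem Invariant.connectedComponentIn {n : ℕ} {Φ : ℝ → Euc n → Euc n} {S : Set (Euc n)}
    (hS : Invariant Φ S) (hΦ : IsFlow Φ) (x : Euc n) :
    Invariant Φ (connectedComponentIn S x) := by
  refine hΦ.invariant_of_forall_mem fun t y hy => ?_
  rw [connectedComponentIn_eq hy]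
  have hcont : Continuous fun t => Φ t y := hΦ.1.comp (by fun_prop : Continuous fun t : ℝ => (t, y))
  refine (isPreconnected_range hcont).subset_connectedComponentIn ⟨0, hΦ.2.1 y⟩ ?_ ⟨t, rfl⟩
  rintro _ ⟨r, rfl⟩
  exact hS.apply_mem r (connectedComponentIn_subset _ _ hy)

end Support

theorem stmt1 {n : ℕ} (hn : 2 ≤ n) (Φ : ℝ → Euc n → Euc n) (Cp Γ : Set (Euc n))
    (hΦ : IsFlow Φ) (hC : IsConeOrder Cp) (hcomp : StronglyCompetitive Φ Cp)
    (hΓ : Dissipative Φ Γ)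
    (μ : MeasureTheory.Measure (Euc n)) (hprob : MeasureTheory.IsProbabilityMeasure μ)
    (hinv : ∀ t : ℝ, ∀ A : Set (Euc n), MeasurableSet A → μ ((Φ t) ⁻¹' A) = μ A) :
    ∀ x ∈ measSupport μ,
      ((connectedComponentIn (measSupport μ) x ⊆ equilibria Φ ∧
        ∀ a ∈ connectedComponentIn (measSupport μ) x,
        ∀ b ∈ connectedComponentIn (measSupport μ) x, a ≠ b →
          coneLL Cp a b ∨ coneLL Cp b a)) ∨
      (∃ M : Set (Euc n), Invariant Φ M ∧ Unordered Cp M ∧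
        Nonempty (↥M ≃ₜ Euc (n - 1)) ∧
        connectedComponentIn (measSupport μ) x ⊆ M) := by
  intro x hx
  have hn0 : 0 < n := by omega
  have hμ : ∀ t : ℝ, MeasureTheory.MeasurePreserving (Φ t) μ μ := fun t =>
    ⟨(hΦ.continuous t).measurable, MeasureTheory.Measure.ext fun A hA => by
      rw [MeasureTheory.Measure.map_apply (hΦ.continuous t).measurable hA, hinv t A hA]⟩
  have hSinv := invariant_measSupport hΦ hμ
  set B := connectedComponentIn (measSupport μ) x
  have hBS : B ⊆ measSupport μ := connectedComponentIn_subset _ _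
  have hBinv : Invariant Φ B := hSinv.connectedComponentIn hΦ x
  have hB : IsPreconnected B := isPreconnected_connectedComponentIn
  by_cases hun : Unordered Cp B
  · exact Or.inr (exists_invariant_unordered_hypersurface hn0 hΦ hC hcomp
      ⟨x, mem_connectedComponentIn hx⟩ ((isBounded_measSupport hΓ hμ).subset hBS) hBinv hun)
  left
  have hll : ∀ y ∈ B, ∀ z ∈ B, y ≠ z → z - y ∈ Cp → z - y ∈ interior Cp :=
    fun y hy z hz => sub_mem_interior_of_mem_measSupport hΦ hC hcomp hμ (hBS hy) (hBS hz)
  have hll' : ∀ y ∈ B, ∀ z ∈ B, y ≠ z → z - y ∈ -Cp → z - y ∈ interior (-Cp) :=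
    fun y hy z hz =>
      sub_mem_interior_of_mem_measSupport hΦ hC.neg hcomp.neg hμ (hBS hy) (hBS hz)
  have hrel : ∀ y ∈ B, ∀ z ∈ B, z ≠ y → (z - y ∈ Cp ∨ y - z ∈ Cp) →
      ∀ w ∈ B, w - y ∈ Cp ∨ y - w ∈ Cp := by
    intro y hy z hz hzy hcmp w hw
    by_contra! hcon
    rcases hcmp with h | h
    · exact hB.not_le_of_incomparable hC hll hy hw hcon.1 hcon.2 hz hzy h
    · refine hB.not_le_of_incomparable hC.neg hll' hy hw ?_ ?_ hz hzy ?_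
      · rw [Set.mem_neg, neg_sub]; exact hcon.2
      · rw [Set.mem_neg, neg_sub]; exact hcon.1
      · rwa [Set.mem_neg, neg_sub]
  obtain ⟨a, ha, b, hb, hab, hle⟩ :
      ∃ a ∈ B, ∃ b ∈ B, a ≠ b ∧ b - a ∈ Cp := by
    simpa only [Unordered, coneLe, not_forall, not_not, exists_prop] using hun
  have htotal : ∀ y ∈ B, ∀ w ∈ B, w - y ∈ Cp ∨ y - w ∈ Cp := by
    intro y hy
    by_cases hya : y = a
    · subst hya
      exact hrel y hy b hb hab.symm (Or.inl hle)
    · exact hrel y hy a ha (Ne.symm hya) (hrel a ha b hb hab.symm (Or.inl hle) y hy).symm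
  refine ⟨fun y hy t => ?_, fun y hy z hz hyz => ?_⟩
  · exact eq_of_comparable_orbit hn0 hΦ hC hcomp hμ (hBS hy)
      (htotal y hy _ (hBinv.apply_mem t hy))
  · exact (htotal y hy z hz).imp (hll y hy z hz hyz) (hll z hz y hy hyz.symm)
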